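/- Let P be a combinatorially symmetric tree sign pattern with 0-diagonal of order n, and let P′ be a negation of P (same zero pattern, 0-diagonal, every edge sign reversed). Then P requires a unique inertia if and only if P′ is consistent. -/

import Mathlib

open Polynomial Matrix

def QClass {n : ℕ} (P : Matrix (Fin n) (Fin n) SignType) (B : Matrix (Fin n) (Fin n) ℝ) : Prop :=
  ∀ i j, SignType.sign (B i j) = P i j

noncomputable def charRoots {n : ℕ} (B : Matrix (Fin n) (Fin n) ℝ) : Multiset ℂ :=
  ((B.charpoly).map (algebraMap ℝ ℂ)).roots

noncomputable def inertia {n : ℕ} (B : Matrix (Fin n) (Fin n) ℝ) : ℕ × ℕ × ℕ :=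
  (((charRoots B).filter (fun z => 0 < z.re)).card,
   ((charRoots B).filter (fun z => z.re < 0)).card,
   ((charRoots B).filter (fun z => z.re = 0)).card)

def RequiresUniqueInertia {n : ℕ} (P : Matrix (Fin n) (Fin n) SignType) : Prop :=
  ∀ B₁ B₂, QClass P B₁ → QClass P B₂ → inertia B₁ = inertia B₂

/-- `P'` is a negation of `P`: same zero pattern, `0`-diagonal, every edge sign reversed. -/
def IsNegationOf {n : ℕ} (P' P : Matrix (Fin n) (Fin n) SignType) : Prop :=
  (∀ i, P' i i = 0) ∧ (∀ i j, P' i j ≠ 0 ↔ P i j ≠ 0) ∧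
    (∀ i j, i ≠ j → P i j ≠ 0 → P' i j * P' j i = -(P i j * P j i))

/-- `P` is consistent: every matrix in the qualitative class of `P` has the same number of
real eigenvalues, counted with algebraic multiplicity. -/
def Consistent {n : ℕ} (P : Matrix (Fin n) (Fin n) SignType) : Prop :=
  ∃ k : ℕ, ∀ B, QClass P B → ((charRoots B).filter (fun z => z.im = 0)).card = k

/-- On a tree, every antisymmetric edge labelling by elements of a group is a coboundary. -/
theorem SimpleGraph.IsTree.exists_potential {V H : Type*} [Group H] {G : SimpleGraph V}
    (hG : G.IsTree) (g : V → V → H) (hg : ∀ v w, G.Adj v w → g v w * g w v = 1) :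
    ∃ d : V → H, ∀ v w, G.Adj v w → d w = d v * g v w := by
  obtain ⟨r⟩ := hG.connected.nonempty
  choose p hp _ using hG.existsUnique_path r
  refine ⟨fun v => ((p v).darts.map fun e => g e.fst e.snd).prod, fun v w h => ?_⟩
  by_cases hv : v ∈ (p w).support
  · simp [hG.isAcyclic.path_concat (hp v) (hp w) h hv]
  · have hw := hG.isAcyclic.mem_support_of_ne_mem_support_of_adj_of_isPath (hp v) (hp w) h hv
    simp [hG.isAcyclic.path_concat (hp w) (hp v) h.symm hw, mul_assoc, hg w v h.symm]

theorem Matrix.charpoly_smul_eq_scaleRoots {ι K : Type*} [Fintype ι] [DecidableEq ι] [Field K]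
    [Infinite K] (M : Matrix ι ι K) {c : K} (hc : c ≠ 0) :
    (c • M).charpoly = M.charpoly.scaleRoots c := by
  refine Polynomial.funext fun z => ?_
  obtain ⟨x, rfl⟩ : ∃ x, z = c * x := ⟨c⁻¹ * z, by field_simp⟩
  have h : scalar ι (c * x) - c • M = c • (scalar ι x - M) := by
    rw [smul_sub, ← smul_eq_mul, scalar_apply, scalar_apply, ← diagonal_smul]
    rfl
  have h' := scaleRoots_eval₂_mul (p := M.charpoly) (RingHom.id K) x c
  simp only [RingHom.id_apply, eval₂_id, charpoly_natDegree_eq_dim] at h'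
  rw [h', eval_charpoly, eval_charpoly, h, det_smul]

theorem Matrix.roots_charpoly_smul {ι K : Type*} [Fintype ι] [DecidableEq ι] [Field K]
    [Infinite K] (M : Matrix ι ι K) {c : K} (hc : c ≠ 0) :
    (c • M).charpoly.roots = M.charpoly.roots.map (c * ·) := by
  rw [charpoly_smul_eq_scaleRoots M hc, roots_scaleRoots _ hc.isUnit]

theorem charRoots_eq_map_of_potential {n : ℕ} (A B : Matrix (Fin n) (Fin n) ℝ) {c : ℂ}
    (hc : c ≠ 0) (d : Fin n → ℂˣ) (h : ∀ i j, (d i : ℂ) * A i j = c * B i j * d j) :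
    charRoots A = (charRoots B).map (c * ·) := by
  have hA : A.map (algebraMap ℝ ℂ) = diagonal (fun i => ((d i)⁻¹ : ℂ)) *
      ((c • B.map (algebraMap ℝ ℂ)) * diagonal (fun i => (d i : ℂ))) := by
    ext i j
    rw [diagonal_mul, mul_diagonal]
    simp [← h i j]
  have hd : diagonal (fun i => (d i : ℂ)) * diagonal (fun i => ((d i)⁻¹ : ℂ)) = 1 := by
    simp [diagonal_mul_diagonal]
  rw [charRoots, charRoots, ← charpoly_map, ← charpoly_map, hA, charpoly_mul_comm, Matrix.mul_assoc,
    hd, Matrix.mul_one, roots_charpoly_smul _ hc]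

/-- If two matrices are supported exactly on the edges of the same tree and their edge products
differ by the factor `c ^ 2`, then their spectra differ by the factor `c`. -/
theorem charRoots_eq_map_of_isTree {n : ℕ} {G : SimpleGraph (Fin n)} (hG : G.IsTree)
    {A B : Matrix (Fin n) (Fin n) ℝ} {c : ℂ} (hc : c ≠ 0)
    (hA : ∀ i j, A i j ≠ 0 ↔ G.Adj i j) (hB : ∀ i j, B i j ≠ 0 ↔ G.Adj i j)
    (h : ∀ i j, G.Adj i j → (A i j * A j i : ℂ) = c ^ 2 * (B i j * B j i)) :
    charRoots A = (charRoots B).map (c * ·) := by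
  classical
  have hA' : ∀ i j, G.Adj i j → (A i j : ℂ) ≠ 0 := fun i j hij => by
    exact_mod_cast (hA i j).2 hij
  have hB' : ∀ i j, G.Adj i j → (B i j : ℂ) ≠ 0 := fun i j hij => by
    exact_mod_cast (hB i j).2 hij
  let g : Fin n → Fin n → ℂˣ := fun i j =>
    if hij : G.Adj i j then Units.mk0 (A i j / (c * B i j))
      (div_ne_zero (hA' i j hij) (mul_ne_zero hc (hB' i j hij))) else 1
  have hg : ∀ i j, G.Adj i j → (g i j : ℂ) = A i j / (c * B i j) := fun i j hij => by
    simp [g, hij]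
  obtain ⟨d, hd⟩ := hG.exists_potential g fun i j hij => Units.ext <| by
    rw [Units.val_mul, hg i j hij, hg j i hij.symm, Units.val_one]
    have := hB' i j hij
    have := hB' j i hij.symm
    field_simp
    linear_combination h i j hij
  refine charRoots_eq_map_of_potential A B hc d fun i j => ?_
  by_cases hij : G.Adj i j
  · have := hB' i j hij
    rw [hd i j hij, Units.val_mul, hg i j hij]
    field_simp
  · have hAij := not_not.1 (mt (hA i j).1 hij)
    have hBij := not_not.1 (mt (hB i j).1 hij)
    simp [hAij, hBij]

theorem QClass.ne_zero_iff {n : ℕ} {P : Matrix (Fin n) (Fin n) SignType}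
    {B : Matrix (Fin n) (Fin n) ℝ} (hB : QClass P B) (i j : Fin n) : B i j ≠ 0 ↔ P i j ≠ 0 := by
  rw [← hB i j, Ne, Ne, sign_eq_zero_iff]

/-- Every matrix in the class of a tree pattern has a partner in the class of the negated
pattern, whose spectrum is rotated by a right angle. -/
theorem QClass.exists_rotation {n : ℕ} {G : SimpleGraph (Fin n)} (hG : G.IsTree)
    {P P' : Matrix (Fin n) (Fin n) SignType}
    (hP : ∀ i j, P i j ≠ 0 ↔ G.Adj i j) (hP' : ∀ i j, P' i j ≠ 0 ↔ G.Adj i j)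
    (hneg : ∀ i j, G.Adj i j → P' i j * P' j i = -(P i j * P j i))
    {B : Matrix (Fin n) (Fin n) ℝ} (hB : QClass P B) :
    ∃ A, QClass P' A ∧ charRoots A = (charRoots B).map (Complex.I * ·) := by
  have hA : QClass P' (Matrix.of fun i j => (P' i j : ℝ) * |B i j|) := fun i j => by
    by_cases hij : G.Adj i j
    · have := (hB.ne_zero_iff i j).2 ((hP i j).2 hij)
      rw [of_apply, sign_mul, sign_pos (abs_pos.2 this), mul_one]
      cases P' i j <;> simp
    · simp [not_not.1 (mt (hP' i j).1 hij)]
  refine ⟨_, hA, charRoots_eq_map_of_isTree hG Complex.I_ne_zero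
    (fun i j => (hA.ne_zero_iff i j).trans (hP' i j))
    (fun i j => (hB.ne_zero_iff i j).trans (hP i j)) fun i j hij => ?_⟩
  have hsign : (P' i j * P' j i : ℝ) = -(P i j * P j i) := by
    have := congrArg (fun s : SignType => (s : ℝ)) (hneg i j hij)
    simpa using this
  have hBs : ∀ i j, (P i j : ℝ) * |B i j| = B i j := fun i j => by
    rw [← hB i j, sign_mul_abs]
  have : (P' i j * |B i j|) * (P' j i * |B j i|) = -(B i j * B j i) := by
    linear_combination (|B i j| * |B j i|) * hsign - hBs i j * (P j i * |B j i|)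
      - B i j * hBs j i
  rw [Complex.I_sq, neg_one_mul]
  exact_mod_cast this

theorem card_charRoots {n : ℕ} (B : Matrix (Fin n) (Fin n) ℝ) : (charRoots B).card = n := by
  rw [charRoots, IsAlgClosed.card_roots_map_eq_natDegree_of_injective _ (algebraMap ℝ ℂ).injective,
    charpoly_natDegree_eq_dim, Fintype.card_fin]

theorem inertia_sum {n : ℕ} (B : Matrix (Fin n) (Fin n) ℝ) :
    (inertia B).1 + (inertia B).2.1 + (inertia B).2.2 = (charRoots B).card := by
  simp only [inertia]
  induction charRoots B using Multiset.induction with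
  | empty => simp
  | cons z s ih =>
    rw [Multiset.card_cons, ← ih]
    rcases lt_trichotomy z.re 0 with h | h | h
    · simp [h, h.le, h.ne]
      omega
    · simp [h]
      omega
    · simp [h, h.le, h.ne']
      omega

/-- For a matrix supported on a tree the spectrum is symmetric under negation, so the inertia is
determined by the number of eigenvalues on the imaginary axis. -/
theorem inertia_eq_of_isTree {n : ℕ} {G : SimpleGraph (Fin n)} (hG : G.IsTree)
    {A B : Matrix (Fin n) (Fin n) ℝ}
    (hA : ∀ i j, A i j ≠ 0 ↔ G.Adj i j) (hB : ∀ i j, B i j ≠ 0 ↔ G.Adj i j)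
    (h : (inertia A).2.2 = (inertia B).2.2) : inertia A = inertia B := by
  have key : ∀ C : Matrix (Fin n) (Fin n) ℝ, (∀ i j, C i j ≠ 0 ↔ G.Adj i j) →
      (inertia C).1 = (inertia C).2.1 ∧
        (inertia C).1 + (inertia C).2.1 + (inertia C).2.2 = n := fun C hC => by
    constructor
    · have hs := charRoots_eq_map_of_isTree hG (neg_ne_zero.2 one_ne_zero : (-1 : ℂ) ≠ 0) hC hC
        fun i j _ => by ring
      simp only [inertia]
      conv_lhs => rw [hs]
      simp [Multiset.filter_map]
    · rw [inertia_sum, card_charRoots]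
  have h1 := key A hA
  have h2 := key B hB
  refine Prod.ext ?_ (Prod.ext ?_ h) <;> omega

/-- A combinatorially symmetric tree sign pattern with `0`-diagonal requires a unique inertia
if and only if its negation is consistent. -/
theorem tree_pattern_unique_inertia_iff_negation_consistent (n : ℕ)
    (P P' : Matrix (Fin n) (Fin n) SignType)
    (hdiag : ∀ i, P i i = 0)
    (hsym : ∀ i j, P i j ≠ 0 ↔ P j i ≠ 0)
    (htree : (SimpleGraph.fromRel (fun i j : Fin n => P i j ≠ 0)).IsTree)
    (hneg : IsNegationOf P' P) :
    RequiresUniqueInertia P ↔ Consistent P' := by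
  set G := SimpleGraph.fromRel (fun i j : Fin n => P i j ≠ 0) with hG
  have hP : ∀ i j, P i j ≠ 0 ↔ G.Adj i j := fun i j => by
    rw [hG, SimpleGraph.fromRel_adj, ← hsym i j, or_self]
    exact ⟨fun h => ⟨fun hij => h (hij ▸ hdiag i), h⟩, And.right⟩
  have hP' : ∀ i j, P' i j ≠ 0 ↔ G.Adj i j := fun i j => (hneg.2.1 i j).trans (hP i j)
  have hprod : ∀ i j, G.Adj i j → P' i j * P' j i = -(P i j * P j i) := fun i j hij =>
    hneg.2.2 i j hij.ne ((hP i j).2 hij)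
  constructor
  · intro hU
    by_cases hne : ∃ B, QClass P B
    · obtain ⟨B₀, hB₀⟩ := hne
      refine ⟨(inertia B₀).2.2, fun A hA => ?_⟩
      obtain ⟨B, hB, hroots⟩ := hA.exists_rotation htree hP' hP fun i j hij => by
        rw [hprod i j hij, neg_neg]
      rw [hU B₀ B hB₀ hB, inertia, hroots]
      simp [Multiset.filter_map]
    · refine ⟨0, fun A hA => (hne ?_).elim⟩
      obtain ⟨B, hB, -⟩ := hA.exists_rotation htree hP' hP fun i j hij => by
        rw [hprod i j hij, neg_neg]
      exact ⟨B, hB⟩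
  · rintro ⟨k, hk⟩ B₁ B₂ hB₁ hB₂
    have key : ∀ B, QClass P B → (inertia B).2.2 = k := fun B hB => by
      obtain ⟨A, hA, hroots⟩ := hB.exists_rotation htree hP hP' hprod
      rw [← hk A hA, hroots, inertia]
      simp [Multiset.filter_map]
    exact inertia_eq_of_isTree htree (fun i j => (hB₁.ne_zero_iff i j).trans (hP i j))
      (fun i j => (hB₂.ne_zero_iff i j).trans (hP i j)) ((key B₁ hB₁).trans (key B₂ hB₂).symm)
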